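/- arXiv:2007.06399 — 2 statements merged into one kernel-verified Lean document; each statement's English description precedes it below -/
import Mathlib

section
/- Let T be a tree of diameter 5 with vertex set {v_1, ..., v_n}, where v_1 and v_2 are its two central vertices (the two adjacent vertices of eccentricity 3). For k = 1, 2, let NL_k be the set of neighbours of v_k other than v_{3-k} that are not leaves of T. Let s_1, ..., s_n be integers with s_i ≥ 2 for all i. If |NL_k| = 1 for some k ∈ {1, 2}, then d̄(T(s_1, ..., s_n)) = 5; that is, T(s_1, ..., s_n) belongs to class C_0. -/
open SimpleGraph

variable {V : Type*}

/-- `D` is an orientation of `G`: every arc of `D` is an edge of `G`, and every edge of `G`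
receives exactly one of the two possible directions. -/
def IsOrientation (G : SimpleGraph V) (D : V → V → Prop) : Prop :=
  (∀ u v, D u v → G.Adj u v) ∧ ∀ u v, G.Adj u v → (D u v ↔ ¬ D v u)

/-- There is a directed walk of length `n` from `u` to `v` in the digraph `D`. -/
def DPath (D : V → V → Prop) : ℕ → V → V → Prop
  | 0, u, v => u = v
  | n + 1, u, v => ∃ w, D u w ∧ DPath D n w v

/-- Directed distance from `u` to `v` (`⊤` if `v` is not reachable from `u`). -/
noncomputable def ddist (D : V → V → Prop) (u v : V) : ℕ∞ :=
  sInf {n : ℕ∞ | ∃ m : ℕ, n = (m : ℕ∞) ∧ DPath D m u v}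

/-- Diameter of a digraph: supremum of directed distances over all ordered pairs. -/
noncomputable def odiam (D : V → V → Prop) : ℕ∞ :=
  ⨆ u : V, ⨆ v : V, ddist D u v

/-- A strong orientation of `G`: an orientation in which every vertex is reachable
from every other vertex by a directed path. -/
def IsStrongOrientation (G : SimpleGraph V) (D : V → V → Prop) : Prop :=
  IsOrientation G D ∧ ∀ u v, ∃ m : ℕ, DPath D m u v

/-- The orientation number of `G`: minimum diameter over all strong orientations. -/
noncomputable def orientNum (G : SimpleGraph V) : ℕ∞ :=
  sInf {d : ℕ∞ | ∃ D : V → V → Prop, IsStrongOrientation G D ∧ d = odiam D}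

/-- The vertex-multiplication `G(s)`: vertex `v` is replaced by `s v` copies, and copies of
`v_i`, `v_j` are adjacent iff `v_i v_j` is an edge of `G` (whence `i ≠ j`). -/
def vertexMult (G : SimpleGraph V) (s : V → ℕ) : SimpleGraph (Σ v : V, Fin (s v)) where
  Adj x y := G.Adj x.1 y.1
  symm := ⟨fun _ _ h => G.symm.symm _ _ h⟩
  loopless := ⟨fun x h => G.loopless.irrefl x.1 h⟩

/-- Eccentricity of a vertex. -/
noncomputable def ecc (G : SimpleGraph V) (v : V) : ℕ∞ :=
  ⨆ u : V, G.edist v u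

/-- The position of a vertex in a tree of diameter `5` with centres `p` (`left`) and `q` (`right`)
in which `p` has a single non-leaf neighbour `u` (`hub`) besides `q`: the other neighbours of `u`
(`spoke`), the leaves at `p` (`leaf`), the other neighbours of `q` (`branch`), and the remaining
vertices (`twig`). -/
inductive Position
  | spoke | hub | left | right | branch | twig | leaf
  deriving DecidableEq

namespace Position

instance : Fintype Position :=
  ⟨{spoke, hub, left, right, branch, twig, leaf}, fun r => by cases r <;> decide⟩

/-- The pairs of positions which edges of the tree may join. -/
def linked : Position → Position → Bool
  | spoke, hub | hub, spoke | hub, left | left, hub | left, right | right, left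
  | right, branch | branch, right | branch, twig | twig, branch | left, leaf | leaf, left => true
  | _, _ => false

/-- The direction of the edges of the vertex-multiplication, in terms of the positions of their ends
and of whether these ends are the first copy (`false`) or a later copy (`true`) of a vertex. -/
def arc : Position × Bool → Position × Bool → Bool
  | (spoke, i), (hub, j) => i == j
  | (hub, i), (spoke, j) => i != j
  | (hub, _), (left, j) => j
  | (left, i), (hub, _) => !i
  | (left, i), (right, _) => i
  | (right, _), (left, j) => !j
  | (right, i), (branch, j) => i != j
  | (branch, i), (right, j) => i == j
  | (branch, i), (twig, _) => !i
  | (twig, _), (branch, j) => j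
  | (left, i), (leaf, _) => !i
  | (leaf, _), (left, j) => j
  | _, _ => false

/-- The arcs whose positions force two vertices to be adjacent in the tree. -/
def rigidArc (σ τ : Position × Bool) : Bool :=
  σ.1 != twig && τ.1 != twig && arc σ τ

/-- The labels of inner vertices of the connecting paths. -/
def inner : List (Position × Bool) :=
  [(spoke, false), (spoke, true), (hub, false), (hub, true), (left, false), (left, true),
    (right, false), (right, true), (branch, false), (branch, true)]

/-- There is a nonempty sequence of at most `n` rigid arcs from `σ` to `τ` through inner labels. -/
def reach : ℕ → Position × Bool → Position × Bool → Bool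
  | 0, _, _ => false
  | n + 1, σ, τ => rigidArc σ τ || inner.any fun ρ => rigidArc σ ρ && reach n ρ τ

/-- The label after the forced first step out of a twig. -/
def start (σ : Position × Bool) : Position × Bool :=
  if σ.1 = twig then (branch, true) else σ

/-- The label before the forced last step into a twig. -/
def finish (τ : Position × Bool) : Position × Bool :=
  if τ.1 = twig then (branch, false) else τ

/-- The number of steps spent at a twig end of a path. -/
def cost (σ : Position × Bool) : ℕ := if σ.1 = twig then 1 else 0

theorem reach_start_finish :
    ∀ σ τ, reach (5 - cost σ - cost τ) (start σ) (finish τ) = true := by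
  decide +kernel

theorem arc_eq_not_arc : ∀ σ τ : Position × Bool, linked σ.1 τ.1 = true →
    arc σ τ = !arc τ σ := by
  decide +kernel

theorem linked_of_rigidArc : ∀ σ τ, rigidArc σ τ = true →
    σ.1 ≠ twig ∧ τ.1 ≠ twig ∧ linked σ.1 τ.1 = true ∧ arc σ τ = true := by
  decide +kernel

theorem ne_twig_and_ne_leaf_of_mem_inner : ∀ σ ∈ inner, σ.1 ≠ twig ∧ σ.1 ≠ leaf := by
  decide +kernel

end Position

open Position

theorem DPath.append {D : V → V → Prop} {m n : ℕ} {a b c : V} (h₁ : DPath D m a b)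
    (h₂ : DPath D n b c) : DPath D (m + n) a c := by
  induction m generalizing a with
  | zero =>
    obtain rfl : a = b := h₁
    simpa using h₂
  | succ m ih =>
    obtain ⟨w, hw, h⟩ := h₁
    rw [Nat.succ_add]
    exact ⟨w, hw, ih h⟩

theorem DPath.single {D : V → V → Prop} {a b : V} (h : D a b) : DPath D 1 a b :=
  ⟨b, h, rfl⟩

theorem edist_le_of_dpath {G : SimpleGraph V} {s : V → ℕ} {D : (Σ v, Fin (s v)) → _ → Prop}
    (hD : IsOrientation (vertexMult G s) D) {m : ℕ} {a b : Σ v, Fin (s v)}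
    (h : DPath D m a b) : G.edist a.1 b.1 ≤ m := by
  induction m generalizing a with
  | zero =>
    obtain rfl : a = b := h
    simp
  | succ m ih =>
    obtain ⟨w, hw, h⟩ := h
    have h₁ : G.edist a.1 w.1 = 1 := edist_eq_one_iff_adj.2 (hD.1 _ _ hw)
    calc G.edist a.1 b.1 ≤ G.edist a.1 w.1 + G.edist w.1 b.1 := SimpleGraph.edist_triangle
      _ ≤ 1 + m := by rw [h₁]; gcongr; exact ih h
      _ = ((m + 1 : ℕ) : ℕ∞) := by push_cast; ring

/-- Orientations of a vertex-multiplication by positive integers have at least the diameter of the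
graph. -/
theorem ediam_le_orientNum [Finite V] [Nonempty V] (G : SimpleGraph V) (s : V → ℕ)
    (hs : ∀ v, 0 < s v) : G.ediam ≤ orientNum (vertexMult G s) := by
  refine le_sInf ?_
  rintro _ ⟨D, hD, rfl⟩
  obtain ⟨x, y, hxy⟩ := exists_edist_eq_ediam_of_finite (G := G)
  rw [← hxy]
  refine le_trans ?_ (le_iSup₂_of_le ⟨x, ⟨0, hs x⟩⟩ ⟨y, ⟨0, hs y⟩⟩ le_rfl)
  refine le_sInf ?_
  rintro _ ⟨m, rfl, hm⟩
  exact edist_le_of_dpath hD.1 hm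

theorem orientNum_le {G : SimpleGraph V} {D : V → V → Prop} {d : ℕ} (hD : IsOrientation G D)
    (h : ∀ a b, ∃ m ≤ d, DPath D m a b) : orientNum G ≤ d := by
  refine sInf_le_of_le ⟨D, ⟨hD, fun a b => (h a b).imp fun _ => And.right⟩, rfl⟩ ?_
  refine iSup₂_le fun a b => ?_
  obtain ⟨m, hm, hp⟩ := h a b
  exact sInf_le_of_le ⟨m, rfl, hp⟩ (by exact_mod_cast hm)

/-- An assignment of positions to the vertices of `T` which is compatible with the edges. -/
structure IsPositioning (T : SimpleGraph V) (pos : V → Position) : Prop where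
  linked_of_adj : ∀ {a b}, T.Adj a b → linked (pos a) (pos b) = true
  adj_of_linked : ∀ {a b}, pos a ≠ twig → pos b ≠ twig → linked (pos a) (pos b) = true → T.Adj a b
  exists_pos : ∀ r, r ≠ twig → r ≠ leaf → ∃ v, pos v = r
  exists_parent : ∀ v, pos v = twig → ∃ w, pos w = branch ∧ T.Adj v w

namespace IsPositioning

variable {T : SimpleGraph V} {pos : V → Position} {s : V → ℕ}

/-- The position of a copy of a vertex, and whether it is not the first copy. -/
def label (pos : V → Position) (a : Σ v, Fin (s v)) : Position × Bool :=
  (pos a.1, decide (a.2.val ≠ 0))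

/-- The orientation of the vertex-multiplication given by `Position.arc`. -/
def orientation (T : SimpleGraph V) (pos : V → Position) (s : V → ℕ) (a b : Σ v, Fin (s v)) :
    Prop :=
  T.Adj a.1 b.1 ∧ arc (label pos a) (label pos b) = true

theorem isOrientation (h : IsPositioning T pos) :
    IsOrientation (vertexMult T s) (orientation T pos s) := by
  refine ⟨fun a b hab => hab.1, fun a b hab => ?_⟩
  have hab' : T.Adj a.1 b.1 := hab
  have := arc_eq_not_arc (label pos a) (label pos b) (h.linked_of_adj hab')
  simp [orientation, hab', hab'.symm, this]

theorem exists_copy (hs : ∀ v, 2 ≤ s v) (v : V) (i : Bool) :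
    ∃ a : Σ v, Fin (s v), a.1 = v ∧ label pos a = (pos v, i) := by
  cases i
  · exact ⟨⟨v, 0, by have := hs v; omega⟩, rfl, by simp [label]⟩
  · exact ⟨⟨v, 1, by have := hs v; omega⟩, rfl, by simp [label]⟩

theorem orientation_of_rigidArc (h : IsPositioning T pos) {a b : Σ v, Fin (s v)}
    (hab : rigidArc (label pos a) (label pos b) = true) : orientation T pos s a b := by
  obtain ⟨ha, hb, hl, harc⟩ := linked_of_rigidArc _ _ hab
  exact ⟨h.adj_of_linked ha hb hl, harc⟩

theorem exists_dpath_of_reach (h : IsPositioning T pos) (hs : ∀ v, 2 ≤ s v) {n : ℕ}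
    {a b : Σ v, Fin (s v)} (hab : reach n (label pos a) (label pos b) = true) :
    ∃ m ≤ n, DPath (orientation T pos s) m a b := by
  induction n generalizing a with
  | zero => simp [reach] at hab
  | succ n ih =>
    simp only [reach, Bool.or_eq_true, List.any_eq_true, Bool.and_eq_true] at hab
    obtain hab | ⟨ρ, hρ, haρ, hρb⟩ := hab
    · exact ⟨1, by omega, .single (h.orientation_of_rigidArc hab)⟩
    · obtain ⟨hρ₁, hρ₂⟩ := ne_twig_and_ne_leaf_of_mem_inner ρ hρ
      obtain ⟨v, hv⟩ := h.exists_pos ρ.1 hρ₁ hρ₂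
      obtain ⟨c, -, hc⟩ := exists_copy (pos := pos) hs v ρ.2
      obtain rfl : label pos c = ρ := by rw [hc, hv]
      obtain ⟨m, hm, hp⟩ := ih hρb
      exact ⟨m + 1, by omega, c, h.orientation_of_rigidArc haρ, hp⟩

theorem exists_start (h : IsPositioning T pos) (hs : ∀ v, 2 ≤ s v) (a : Σ v, Fin (s v)) :
    ∃ c, label pos c = start (label pos a) ∧
      DPath (orientation T pos s) (cost (label pos a)) a c := by
  by_cases ha : pos a.1 = twig
  · obtain ⟨w, hw, haw⟩ := h.exists_parent a.1 ha
    obtain ⟨c, rfl, hc⟩ := exists_copy (pos := pos) hs w true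
    refine ⟨c, by rw [hc, hw, start, if_pos (by exact ha)], ?_⟩
    rw [cost, if_pos (by exact ha)]
    exact .single ⟨haw, by rw [hc, hw]; simp [label, ha, arc]⟩
  · refine ⟨a, by simp [start, label, ha], ?_⟩
    rw [cost, if_neg (by exact ha)]
    rfl

theorem exists_finish (h : IsPositioning T pos) (hs : ∀ v, 2 ≤ s v) (b : Σ v, Fin (s v)) :
    ∃ c, label pos c = finish (label pos b) ∧
      DPath (orientation T pos s) (cost (label pos b)) c b := by
  by_cases hb : pos b.1 = twig
  · obtain ⟨w, hw, hbw⟩ := h.exists_parent b.1 hb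
    obtain ⟨c, rfl, hc⟩ := exists_copy (pos := pos) hs w false
    refine ⟨c, by rw [hc, hw, finish, if_pos (by exact hb)], ?_⟩
    rw [cost, if_pos (by exact hb)]
    exact .single ⟨hbw.symm, by rw [hc, hw]; simp [label, hb, arc]⟩
  · refine ⟨b, by simp [finish, label, hb], ?_⟩
    rw [cost, if_neg (by exact hb)]
    rfl

theorem cost_le_one (σ : Position × Bool) : cost σ ≤ 1 := by
  unfold cost
  split <;> omega

theorem orientNum_vertexMult_le (h : IsPositioning T pos) (hs : ∀ v, 2 ≤ s v) :
    orientNum (vertexMult T s) ≤ 5 := by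
  refine orientNum_le (d := 5) h.isOrientation fun a b => ?_
  obtain ⟨a', ha', hpa⟩ := h.exists_start hs a
  obtain ⟨b', hb', hpb⟩ := h.exists_finish hs b
  have hr := reach_start_finish (label pos a) (label pos b)
  rw [← ha', ← hb'] at hr
  obtain ⟨m, hm, hp⟩ := h.exists_dpath_of_reach hs hr
  have := cost_le_one (label pos a)
  have := cost_le_one (label pos b)
  exact ⟨_, by omega, (hpa.append hp).append hpb⟩

end IsPositioning

namespace SimpleGraph.IsAcyclic

variable {G : SimpleGraph V} {a b c d e : V}

theorem not_adj_of_adj_adj (hG : G.IsAcyclic) (hab : G.Adj a b) (hbc : G.Adj b c) :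
    ¬ G.Adj a c := by
  intro hac
  have := congrArg (fun w => w.1.length) <| (hG.subsingleton_path _ _).elim
    ⟨.cons hac .nil, by simp [hac.ne]⟩
    ⟨.cons hab (.cons hbc .nil), by simp [hab.ne, hbc.ne, hac.ne]⟩
  simp at this

theorem eq_of_adj_adj (hG : G.IsAcyclic) (hac : a ≠ c) (hab : G.Adj a b) (hbc : G.Adj b c)
    (had : G.Adj a d) (hdc : G.Adj d c) : b = d := by
  have := congrArg (fun w => w.1.support) <| (hG.subsingleton_path _ _).elim
    ⟨.cons hab (.cons hbc .nil), by simp [hab.ne, hbc.ne, hac]⟩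
    ⟨.cons had (.cons hdc .nil), by simp [had.ne, hdc.ne, hac]⟩
  simpa using this

theorem not_five_cycle (hG : G.IsAcyclic) (hab : G.Adj a b) (hbc : G.Adj b c) (hcd : G.Adj c d)
    (hde : G.Adj d e) : ¬ G.Adj e a := by
  intro hea
  have hac : a ≠ c := by
    rintro rfl
    exact hG.not_adj_of_adj_adj hcd hde hea.symm
  have had : a ≠ d := by
    rintro rfl
    exact hG.not_adj_of_adj_adj hab hbc hcd.symm
  have hbd : b ≠ d := by
    rintro rfl
    exact hG.not_adj_of_adj_adj hab hde hea.symm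
  have hce : c ≠ e := by
    rintro rfl
    exact hG.not_adj_of_adj_adj hab hbc hea.symm
  have := congrArg (fun w => w.1.length) <| (hG.subsingleton_path _ _).elim
    ⟨.cons hab (.cons hbc (.cons hcd .nil)),
      by simp [hab.ne, hbc.ne, hcd.ne, hac, had, hbd]⟩
    ⟨.cons hea.symm (.cons hde.symm .nil), by simp [hea.ne', hde.ne', had]⟩
  simp at this

end SimpleGraph.IsAcyclic

open scoped Classical in
/-- The position of a vertex `v` in a tree with centres `p` and `q`, where `u` is the only non-leaf
neighbour of `p` other than `q`. -/
noncomputable def position (T : SimpleGraph V) (p q u v : V) : Position :=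
  if v = p then left else if v = q then right else if v = u then hub
  else if T.Adj p v then leaf else if T.Adj u v then spoke
  else if T.Adj q v then branch else twig

theorem position_cases (T : SimpleGraph V) (p q u v : V) :
    (position T p q u v = left ∧ v = p) ∨ (position T p q u v = right ∧ v = q) ∨
    (position T p q u v = hub ∧ v = u) ∨
    (position T p q u v = leaf ∧ T.Adj p v ∧ v ≠ q ∧ v ≠ u) ∨
    (position T p q u v = spoke ∧ T.Adj u v ∧ v ≠ p) ∨
    (position T p q u v = branch ∧ T.Adj q v ∧ v ≠ p) ∨
    (position T p q u v = twig ∧ v ≠ p ∧ v ≠ q ∧ v ≠ u ∧ ¬ T.Adj p v ∧ ¬ T.Adj u v ∧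
      ¬ T.Adj q v) := by
  by_cases h₁ : v = p
  · exact .inl ⟨by simp [position, h₁], h₁⟩
  by_cases h₂ : v = q
  · exact .inr (.inl ⟨by simp [position, h₂ ▸ h₁, h₂], h₂⟩)
  by_cases h₃ : v = u
  · exact .inr (.inr (.inl ⟨by simp [position, h₃ ▸ h₁, h₃ ▸ h₂, h₃], h₃⟩))
  refine .inr (.inr (.inr ?_))
  by_cases h₄ : T.Adj p v
  · exact .inl ⟨by simp [position, *], h₄, h₂, h₃⟩
  by_cases h₅ : T.Adj u v
  · exact .inr (.inl ⟨by simp [position, *], h₅, h₁⟩)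
  by_cases h₆ : T.Adj q v
  · exact .inr (.inr (.inl ⟨by simp [position, *], h₆, h₁⟩))
  exact .inr (.inr (.inr ⟨by simp [position, *], h₁, h₂, h₃, h₄, h₅, h₆⟩))

/-- The local structure of a tree with centres `p` and `q`, where `u` is the only non-leaf
neighbour of `p` other than `q`. -/
structure IsCentralTriple (T : SimpleGraph V) (p q u : V) : Prop where
  acyclic : T.IsAcyclic
  adj_right : T.Adj p q
  adj_hub : T.Adj p u
  hub_ne : u ≠ q
  eq_of_leaf : ∀ {v b}, T.Adj p v → v ≠ q → v ≠ u → T.Adj v b → b = p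
  eq_of_spoke : ∀ {v b}, T.Adj u v → v ≠ p → T.Adj v b → b = u
  exists_spoke : ∃ v, T.Adj u v ∧ v ≠ p
  exists_branch : ∃ v, T.Adj q v ∧ v ≠ p
  exists_parent : ∀ {v}, v ≠ p → v ≠ q → v ≠ u → ¬ T.Adj p v → ¬ T.Adj u v → ¬ T.Adj q v →
    ∃ w, T.Adj q w ∧ w ≠ p ∧ T.Adj v w

namespace IsCentralTriple

variable {T : SimpleGraph V} {p q u : V}

theorem not_adj_right (h : IsCentralTriple T p q u) {v : V} (huv : T.Adj u v) (hvp : v ≠ p) :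
    ¬ T.Adj q v := fun hqv =>
  h.hub_ne (h.acyclic.eq_of_adj_adj hvp.symm h.adj_hub huv h.adj_right hqv)

theorem position_of_spoke (h : IsCentralTriple T p q u) {v : V} (huv : T.Adj u v) (hvp : v ≠ p) :
    position T p q u v = spoke := by
  have h₁ : v ≠ q := fun hv => h.acyclic.not_adj_of_adj_adj h.adj_hub (hv ▸ huv) h.adj_right
  simp [position, hvp, h₁, huv.ne', h.acyclic.not_adj_of_adj_adj h.adj_hub huv, huv]

theorem position_of_branch (h : IsCentralTriple T p q u) {v : V} (hqv : T.Adj q v) (hvp : v ≠ p) :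
    position T p q u v = branch := by
  have h₁ : v ≠ u := fun hv => h.acyclic.not_adj_of_adj_adj h.adj_right (hv ▸ hqv) h.adj_hub
  have h₂ : ¬ T.Adj u v := fun hv => h.not_adj_right hv hvp hqv
  simp [position, hvp, h₁, hqv.ne', h.acyclic.not_adj_of_adj_adj h.adj_right hqv, hqv, h₂]

theorem linked_of_adj (h : IsCentralTriple T p q u) {a b : V} (hab : T.Adj a b) :
    linked (position T p q u a) (position T p q u b) = true := by
  have tri {a b c : V} (hab : T.Adj a b) (hbc : T.Adj b c) : ¬ T.Adj a c :=
    h.acyclic.not_adj_of_adj_adj hab hbc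
  have not_adj_right {v : V} := h.not_adj_right (v := v)
  have leaf₁ {v b : V} := h.eq_of_leaf (v := v) (b := b)
  have spoke₁ {v b : V} := h.eq_of_spoke (v := v) (b := b)
  have twigs (h₁ : a ≠ p ∧ a ≠ q ∧ a ≠ u ∧ ¬ T.Adj p a ∧ ¬ T.Adj u a ∧ ¬ T.Adj q a)
      (h₂ : b ≠ p ∧ b ≠ q ∧ b ≠ u ∧ ¬ T.Adj p b ∧ ¬ T.Adj u b ∧ ¬ T.Adj q b) : False := by
    obtain ⟨h₁₁, h₁₂, h₁₃, h₁₄, h₁₅, h₁₆⟩ := h₁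
    obtain ⟨h₂₁, h₂₂, h₂₃, h₂₄, h₂₅, h₂₆⟩ := h₂
    obtain ⟨c, hqc, -, hac⟩ := h.exists_parent h₁₁ h₁₂ h₁₃ h₁₄ h₁₅ h₁₆
    obtain ⟨d, hqd, -, hbd⟩ := h.exists_parent h₂₁ h₂₂ h₂₃ h₂₄ h₂₅ h₂₆
    exact h.acyclic.not_five_cycle hab hbd hqd.symm hqc hac.symm
  obtain ⟨-, hpq, hpu, huq, -, -, -, -, -⟩ := h
  have hba := hab.symm
  have hqp := hpq.symm
  have hup := hpu.symm
  rcases position_cases T p q u a with ⟨h₁, h₁'⟩ | ⟨h₁, h₁'⟩ | ⟨h₁, h₁'⟩ | ⟨h₁, h₁'⟩ | ⟨h₁, h₁'⟩ |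
      ⟨h₁, h₁'⟩ | ⟨h₁, h₁'⟩ <;>
    rcases position_cases T p q u b with ⟨h₂, h₂'⟩ | ⟨h₂, h₂'⟩ | ⟨h₂, h₂'⟩ | ⟨h₂, h₂'⟩ |
      ⟨h₂, h₂'⟩ | ⟨h₂, h₂'⟩ | ⟨h₂, h₂'⟩ <;>
    rw [h₁, h₂] <;>
    first
    | rfl
    | exfalso
      clear h₁ h₂
      grind

theorem adj_of_linked (h : IsCentralTriple T p q u) {a b : V} (ha : position T p q u a ≠ twig)
    (hb : position T p q u b ≠ twig)
    (hl : linked (position T p q u a) (position T p q u b) = true) : T.Adj a b := by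
  have hpq := h.adj_right
  have hpu := h.adj_hub
  have hqp := hpq.symm
  have hup := hpu.symm
  rcases position_cases T p q u a with h | h | h | h | h | h | h <;>
    rcases position_cases T p q u b with h' | h' | h' | h' | h' | h' | h' <;>
    rw [h.1, h'.1] at hl <;> simp_all [linked, T.adj_comm]

theorem isPositioning (h : IsCentralTriple T p q u) : IsPositioning T (position T p q u) where
  linked_of_adj := h.linked_of_adj
  adj_of_linked := h.adj_of_linked
  exists_pos r hr₁ hr₂ := by
    cases r with
    | spoke =>
      obtain ⟨x, hux, hxp⟩ := h.exists_spoke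
      exact ⟨x, h.position_of_spoke hux hxp⟩
    | hub => exact ⟨u, by simp [position, h.adj_hub.ne', h.hub_ne]⟩
    | left => exact ⟨p, by simp [position]⟩
    | right => exact ⟨q, by simp [position, h.adj_right.ne']⟩
    | branch =>
      obtain ⟨x, hqx, hxp⟩ := h.exists_branch
      exact ⟨x, h.position_of_branch hqx hxp⟩
    | twig => exact absurd rfl hr₁
    | leaf => exact absurd rfl hr₂
  exists_parent v hv := by
    obtain ⟨h₁, h₂, h₃, h₄, h₅, h₆⟩ : v ≠ p ∧ v ≠ q ∧ v ≠ u ∧ ¬ T.Adj p v ∧ ¬ T.Adj u v ∧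
        ¬ T.Adj q v := by
      have := position_cases T p q u v
      simpa [hv] using this
    obtain ⟨w, hqw, hwp, hvw⟩ := h.exists_parent h₁ h₂ h₃ h₄ h₅ h₆
    exact ⟨w, h.position_of_branch hqw hwp, hvw⟩

end IsCentralTriple

theorem exists_isCentralTriple {T : SimpleGraph V} (hT : T.IsTree) {p q : V} (hpq : T.Adj p q)
    (hp : ecc T p = 3) (hq : ecc T q = 3)
    (hNL : {u : V | T.Adj p u ∧ u ≠ q ∧ (T.neighborSet u).ncard ≠ 1}.ncard = 1) :
    ∃ u, IsCentralTriple T p q u := by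
  obtain ⟨u, hu⟩ := Set.ncard_eq_one.1 hNL
  have mem (v : V) : (T.Adj p v ∧ v ≠ q ∧ (T.neighborSet v).ncard ≠ 1) ↔ v = u := by
    simpa using Set.ext_iff.1 hu v
  obtain ⟨hpu, huq, hu₁⟩ := (mem u).2 rfl
  have eq_of_leaf {v b : V} (hpv : T.Adj p v) (hvq : v ≠ q) (hvu : v ≠ u) (hvb : T.Adj v b) :
      b = p := by
    have h₁ : (T.neighborSet v).ncard = 1 := by
      by_contra h
      exact hvu ((mem v).1 ⟨hpv, hvq, h⟩)
    obtain ⟨c, hc⟩ := Set.ncard_eq_one.1 h₁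
    have hb : b ∈ T.neighborSet v := hvb
    have hp : p ∈ T.neighborSet v := hpv.symm
    rw [hc, Set.mem_singleton_iff] at hb hp
    rw [hb, hp]
  have exists_spoke : ∃ x, T.Adj u x ∧ x ≠ p := by
    by_contra! h
    refine hu₁ (Set.ncard_eq_one.2 ⟨p, Set.ext fun v => ⟨h v, ?_⟩⟩)
    rintro rfl
    exact hpu.symm
  have tri {a b c : V} (hab : T.Adj a b) (hbc : T.Adj b c) : ¬ T.Adj a c :=
    hT.isAcyclic.not_adj_of_adj_adj hab hbc
  have eq_of_spoke {y z : V} (huy : T.Adj u y) (hyp : y ≠ p) (hyz : T.Adj y z) : z = u := by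
    classical
    by_contra hzu
    have hqz : T.edist q z ≤ 3 := hq ▸ le_iSup (T.edist q) z
    obtain ⟨w, hw⟩ := hT.connected.exists_walk_length_eq_edist q z
    have hqy : q ≠ y := by
      rintro rfl
      exact tri hpu huy hpq
    have hqz' : q ≠ z := by
      rintro rfl
      exact huq (hT.isAcyclic.eq_of_adj_adj hyp.symm hpu huy hpq hyz.symm)
    have hpz : p ≠ z := by
      rintro rfl
      exact tri huy hyz hpu.symm
    have hpath := congrArg (fun w => w.1.length) <| (hT.isAcyclic.subsingleton_path _ _).elim
      ⟨.cons hpq.symm (.cons hpu (.cons huy (.cons hyz .nil))),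
        by simp [hpq.ne', hpu.ne, huy.ne, hyz.ne, huq.symm, hqy, hqz', hyp.symm, hpz, Ne.symm hzu]⟩
      w.toPath
    have hlen : w.toPath.1.length ≤ w.length := w.length_bypass_le_length
    rw [← hw] at hqz
    have : w.length ≤ 3 := by exact_mod_cast hqz
    simp only [Walk.length_cons, Walk.length_nil] at hpath
    omega
  have exists_parent {v : V} (hvp : v ≠ p) (hvq : v ≠ q) (hvu : v ≠ u) (hpv : ¬ T.Adj p v)
      (huv : ¬ T.Adj u v) (hqv : ¬ T.Adj q v) : ∃ w, T.Adj q w ∧ w ≠ p ∧ T.Adj v w := by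
    have hpv₃ : T.edist p v ≤ 3 := hp ▸ le_iSup (T.edist p) v
    obtain ⟨w, hw⟩ := hT.connected.exists_walk_length_eq_edist p v
    rw [← hw] at hpv₃
    have hlen : w.length ≤ 3 := by exact_mod_cast hpv₃
    clear hw hpv₃
    have near {a : V} (hpa : T.Adj p a) : ¬ T.Adj a v := fun hav => by
      by_cases haq : a = q
      · exact hqv (haq ▸ hav)
      by_cases hau : a = u
      · exact huv (hau ▸ hav)
      exact hvp (eq_of_leaf hpa haq hau hav)
    match w with
    | .nil => exact absurd rfl hvp
    | .cons h .nil => exact absurd h hpv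
    | .cons h (.cons h' .nil) => exact absurd h' (near h)
    | .cons (v := a) h (.cons (v := b) h' (.cons h'' .nil)) =>
      have hbp : b ≠ p := by
        rintro rfl
        exact hpv h''
      by_cases haq : a = q
      · exact ⟨b, haq ▸ h', hbp, h''.symm⟩
      by_cases hau : a = u
      · exact absurd (eq_of_spoke (hau ▸ h') hbp h'') hvu
      exact absurd (eq_of_leaf h haq hau h') hbp
    | .cons _ (.cons _ (.cons _ (.cons _ _))) => simp only [Walk.length_cons] at hlen; omega
  have exists_branch : ∃ v, T.Adj q v ∧ v ≠ p := by
    by_contra! h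
    have hp₂ : ecc T p ≤ 2 := by
      refine iSup_le fun v => ?_
      have of_walk (w : T.Walk p v) (hw : w.length ≤ 2) : T.edist p v ≤ 2 :=
        (edist_le w).trans (by exact_mod_cast hw)
      by_cases hpv : T.Adj p v
      · exact of_walk (.cons hpv .nil) (by simp)
      by_cases huv : T.Adj u v
      · exact of_walk (.cons hpu (.cons huv .nil)) (by simp)
      by_cases hvp : v = p
      · simp [hvp]
      obtain ⟨w, hqw, hwp, -⟩ := exists_parent hvp (fun hv => hpv (hv ▸ hpq))
        (fun hv => hpv (hv ▸ hpu)) hpv huv fun hv => hvp (h v hv)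
      exact absurd (h w hqw) hwp
    rw [hp] at hp₂
    exact absurd hp₂ (by decide)
  exact ⟨u, hT.isAcyclic, hpq, hpu, huq, eq_of_leaf, eq_of_spoke, exists_spoke, exists_branch,
    exists_parent⟩

theorem stmt11 [Fintype V] (T : SimpleGraph V) (hT : T.IsTree) (hdiam : T.ediam = 5)
    (v₁ v₂ : V) (hadj : T.Adj v₁ v₂) (hecc₁ : ecc T v₁ = 3) (hecc₂ : ecc T v₂ = 3)
    (s : V → ℕ) (hs : ∀ v, 2 ≤ s v)
    (NL₁ NL₂ : Set V)
    (hNL₁ : NL₁ = {u : V | T.Adj v₁ u ∧ u ≠ v₂ ∧ (T.neighborSet u).ncard ≠ 1})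
    (hNL₂ : NL₂ = {u : V | T.Adj v₂ u ∧ u ≠ v₁ ∧ (T.neighborSet u).ncard ≠ 1})
    (h : NL₁.ncard = 1 ∨ NL₂.ncard = 1) :
    orientNum (vertexMult T s) = 5 := by
  subst hNL₁ hNL₂
  have : Nonempty V := ⟨v₁⟩
  refine le_antisymm ?_ (hdiam ▸ ediam_le_orientNum T s fun v => by have := hs v; omega)
  rcases h with h | h
  · obtain ⟨u, hu⟩ := exists_isCentralTriple hT hadj hecc₁ hecc₂ h
    exact hu.isPositioning.orientNum_vertexMult_le hs
  · obtain ⟨u, hu⟩ := exists_isCentralTriple hT hadj.symm hecc₂ hecc₁ h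
    exact hu.isPositioning.orientNum_vertexMult_le hs
end

section
/- Let T be a tree of diameter 5 with vertex set {v_1, ..., v_n}, where v_1 and v_2 are its two central vertices (the two adjacent vertices of eccentricity 3). Let H be the vertex-multiplication T(s_1, ..., s_n) in which the multiplicity of v_1 is 3 and the multiplicity of every other vertex is 2. Then H admits an orientation D of diameter 5 in which every vertex lies on a directed cycle of length at most 4. -/
open SimpleGraph

variable {V : Type*}

section Digraph

variable {W : Type*} {D : W → W → Prop}

lemma DPath.single_s14 {x y : W} (h : D x y) : DPath D 1 x y := ⟨y, h, rfl⟩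

lemma DPath.trans {k l : ℕ} {x y z : W} (h₁ : DPath D k x y) (h₂ : DPath D l y z) :
    DPath D (k + l) x z := by
  induction k generalizing x with
  | zero =>
    obtain rfl : x = y := h₁
    simpa using h₂
  | succ k ih =>
    obtain ⟨w, hw, h⟩ := h₁
    rw [Nat.succ_add]
    exact ⟨w, hw, ih h⟩

lemma ddist_le_of_dPath {k n : ℕ} {x y : W} (h : DPath D k x y) (hk : k ≤ n) :
    ddist D x y ≤ n :=
  sInf_le_of_le ⟨k, rfl, h⟩ (by exact_mod_cast hk)

/-- A partial choice of directions extends to an orientation of the whole graph. -/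
lemma exists_isOrientation_of_asymm (G : SimpleGraph W) (F : W → W → Prop)
    (hF : ∀ x y, F x y → ¬ F y x) :
    ∃ D, IsOrientation G D ∧ ∀ x y, G.Adj x y → F x y → D x y := by
  refine ⟨fun x y => G.Adj x y ∧ (F x y ∨ ¬ F y x ∧ WellOrderingRel x y),
    ⟨fun x y h => h.1, fun x y hxy => ?_⟩, fun x y hxy h => ⟨hxy, Or.inl h⟩⟩
  have asymm : WellOrderingRel x y → ¬ WellOrderingRel y x := fun h h' => _root_.asymm h h'
  have total := trichotomous_of (WellOrderingRel (α := W)) x y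
  have ne := hxy.ne
  have symm := hxy.symm
  have := hF x y
  tauto

end Digraph

section Multiplication

variable {T : SimpleGraph V} {s : V → ℕ} {D : (Σ v : V, Fin (s v)) → (Σ v : V, Fin (s v)) → Prop}

lemma edist_le_of_dPath (hD : IsOrientation (vertexMult T s) D) {k : ℕ}
    {x y : Σ v : V, Fin (s v)} (h : DPath D k x y) : T.edist x.1 y.1 ≤ k := by
  induction k generalizing x with
  | zero =>
    obtain rfl : x = y := h
    simp
  | succ k ih =>
    obtain ⟨w, hw, h⟩ := h
    have hadj : T.Adj x.1 w.1 := hD.1 x w hw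
    calc T.edist x.1 y.1 ≤ T.edist x.1 w.1 + T.edist w.1 y.1 := T.edist_triangle
      _ ≤ 1 + k := add_le_add (edist_eq_one_iff_adj.2 hadj).le (ih h)
      _ = ((k + 1 : ℕ) : ℕ∞) := by push_cast; exact add_comm _ _

lemma ediam_le_odiam (hs : ∀ v, 0 < s v) (hD : IsOrientation (vertexMult T s) D) :
    T.ediam ≤ odiam D := by
  refine ediam_le_of_edist_le fun u v => ?_
  refine le_trans ?_ (le_iSup₂ (f := fun x y => ddist D x y) ⟨u, ⟨0, hs u⟩⟩ ⟨v, ⟨0, hs v⟩⟩)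
  refine le_sInf ?_
  rintro _ ⟨m, rfl, h⟩
  exact edist_le_of_dPath hD h

end Multiplication

/-- The position of a vertex in a tree of diameter 5: one of the two centers, another neighbor of
one of the centers, or a vertex at distance 2 from the nearer center. -/
inductive Role
  | center₁ | center₂ | inner₁ | inner₂ | leaf₁ | leaf₂

open Classical in
/-- The role of a vertex with respect to the centers `v₁` and `v₂`. -/
noncomputable def role (T : SimpleGraph V) (v₁ v₂ v : V) : Role :=
  if v = v₁ then .center₁
  else if v = v₂ then .center₂
  else if T.Adj v₁ v then .inner₁
  else if T.Adj v₂ v then .inner₂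
  else if ∃ a, T.Adj v₁ a ∧ T.Adj a v then .leaf₁
  else .leaf₂

/-- The direction pattern: whether the `i`-th copy of a vertex points to the `j`-th copy of an
adjacent one, depending on their roles. -/
def arc : Role → ℕ → Role → ℕ → Prop
  | .center₁, i, .center₂, _ => i = 2
  | .center₂, _, .center₁, j => j ≠ 2
  | .center₁, i, .inner₁, j => i ≠ 2 ∧ i ≠ j
  | .inner₁, i, .center₁, j => j = 2 ∨ i = j
  | .center₂, i, .inner₂, j => i ≠ j
  | .inner₂, i, .center₂, j => i = j
  | .inner₁, i, .leaf₁, _ => i = 0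
  | .leaf₁, _, .inner₁, j => j ≠ 0
  | .inner₂, i, .leaf₂, _ => i = 0
  | .leaf₂, _, .inner₂, j => j ≠ 0
  | _, _, _, _ => False

lemma arc_asymm (r r' : Role) (i j : ℕ) (h : arc r i r' j) : ¬ arc r' j r i := by
  cases r <;> cases r' <;> simp only [arc] at h ⊢ <;> grind

section Tree

variable {T : SimpleGraph V} {v₁ v₂ : V}

lemma dist_le_of_ecc_eq (hT : T.IsTree) {u : V} {n : ℕ} (h : ecc T u = n) (v : V) :
    T.dist u v ≤ n := by
  have := le_iSup (fun w => T.edist u w) v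
  rw [← (hT.connected u v).coe_dist_eq_edist] at this
  exact_mod_cast this.trans h.le

lemma exists_dist_eq_of_ecc_eq [Finite V] (hT : T.IsTree) {u : V} {n : ℕ} (h : ecc T u = n) :
    ∃ v, T.dist u v = n := by
  obtain ⟨v, hv⟩ := exists_edist_eq_eccent_of_finite (G := T) u
  refine ⟨v, ?_⟩
  rw [← (hT.connected u v).coe_dist_eq_edist] at hv
  exact_mod_cast hv.trans h

lemma exists_adj_adj_of_dist_eq_two (hT : T.IsTree) {u v : V} (h : T.dist u v = 2) :
    ∃ a, T.Adj u a ∧ T.Adj a v := by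
  have h2 : T.edist u v = 2 := by
    rw [← (hT.connected u v).coe_dist_eq_edist, h]; rfl
  obtain ⟨-, -, a, ha⟩ := edist_eq_two_iff.1 h2
  rw [mem_commonNeighbors] at ha
  exact ⟨a, ha.1, ha.2.symm⟩

/-- If both endpoints of an edge of a tree have eccentricity 3, then each has another neighbor. -/
lemma exists_adj_ne_of_ecc_eq_three [Finite V] (hT : T.IsTree) {u w : V} (hadj : T.Adj u w)
    (hu : ecc T u = 3) (hw : ecc T w = 3) : ∃ a, T.Adj u a ∧ a ≠ w := by
  obtain ⟨x, hx⟩ := exists_dist_eq_of_ecc_eq (n := 3) hT hw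
  have hux := dist_le_of_ecc_eq (n := 3) hT hu x
  have hdist := hT.dist_eq_dist_add_one_of_adj x hadj
  rw [T.dist_comm (u := x) (v := u), T.dist_comm (u := x) (v := w)] at hdist
  obtain ⟨a, hua, hax⟩ := exists_adj_adj_of_dist_eq_two hT (u := u) (v := x) (by omega)
  refine ⟨a, hua, ?_⟩
  rintro rfl
  have := dist_eq_one_iff_adj.2 hax
  omega

lemma IsTree.not_adj_of_adj_of_adj (hT : T.IsTree) {u v w : V} (huv : T.Adj u v)
    (hvw : T.Adj v w) : ¬ T.Adj u w := by
  intro huw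
  have := hT.dist_ne_of_adj u hvw
  rw [dist_eq_one_iff_adj.2 huv, dist_eq_one_iff_adj.2 huw] at this
  exact this rfl

lemma role_center₁ : role T v₁ v₂ v₁ = .center₁ := by simp [role]

lemma role_center₂ (hadj : T.Adj v₁ v₂) : role T v₁ v₂ v₂ = .center₂ := by
  simp [role, hadj.ne']

lemma role_inner₁ {a : V} (h : T.Adj v₁ a) (ha : a ≠ v₂) : role T v₁ v₂ a = .inner₁ := by
  simp [role, h, ha, h.ne']

lemma role_inner₂ (hT : T.IsTree) (hadj : T.Adj v₁ v₂) {b : V} (h : T.Adj v₂ b) (hb : b ≠ v₁) :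
    role T v₁ v₂ b = .inner₂ := by
  simp [role, h, hb, h.ne', IsTree.not_adj_of_adj_of_adj hT hadj h]

lemma eq_of_role_center₁ {v : V} (h : role T v₁ v₂ v = .center₁) : v = v₁ := by
  unfold role at h
  split_ifs at h
  assumption

lemma eq_of_role_center₂ {v : V} (h : role T v₁ v₂ v = .center₂) : v = v₂ := by
  unfold role at h
  split_ifs at h
  assumption

lemma adj_of_role_inner₁ {v : V} (h : role T v₁ v₂ v = .inner₁) : T.Adj v₁ v := by
  unfold role at h
  split_ifs at h
  assumption

lemma adj_of_role_inner₂ {v : V} (h : role T v₁ v₂ v = .inner₂) : T.Adj v₂ v := by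
  unfold role at h
  split_ifs at h
  assumption

lemma exists_inner₁_of_role_leaf₁ {v : V} (h : role T v₁ v₂ v = .leaf₁) :
    ∃ a, role T v₁ v₂ a = .inner₁ ∧ T.Adj a v := by
  obtain ⟨a, ha, hav⟩ : ∃ a, T.Adj v₁ a ∧ T.Adj a v := by
    unfold role at h
    split_ifs at h
    assumption
  refine ⟨a, role_inner₁ ha ?_, hav⟩
  rintro rfl
  unfold role at h
  split_ifs at h

lemma exists_inner₂_of_role_leaf₂ (hT : T.IsTree) (hadj : T.Adj v₁ v₂) (hecc₁ : ecc T v₁ = 3)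
    (hecc₂ : ecc T v₂ = 3) {v : V} (h : role T v₁ v₂ v = .leaf₂) :
    ∃ b, role T v₁ v₂ b = .inner₂ ∧ T.Adj b v := by
  obtain ⟨hne₁, hne₂, h₁, h₂, hno⟩ : v ≠ v₁ ∧ v ≠ v₂ ∧ ¬ T.Adj v₁ v ∧ ¬ T.Adj v₂ v ∧
      ¬ ∃ a, T.Adj v₁ a ∧ T.Adj a v := by
    unfold role at h
    split_ifs at h
    exact ⟨‹_›, ‹_›, ‹_›, ‹_›, ‹_›⟩
  have hdist := hT.dist_eq_dist_add_one_of_adj v hadj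
  rw [T.dist_comm (u := v) (v := v₁), T.dist_comm (u := v) (v := v₂)] at hdist
  have := dist_le_of_ecc_eq (n := 3) hT hecc₁ v
  have := dist_le_of_ecc_eq (n := 3) hT hecc₂ v
  have := hT.connected.one_lt_dist_of_ne_of_not_adj hne₁.symm h₁
  have := hT.connected.one_lt_dist_of_ne_of_not_adj hne₂.symm h₂
  have : T.dist v₁ v ≠ 2 := fun h => hno (exists_adj_adj_of_dist_eq_two hT h)
  obtain ⟨b, hb, hbv⟩ := exists_adj_adj_of_dist_eq_two hT (u := v₂) (v := v) (by omega)
  refine ⟨b, role_inner₂ hT hadj hb ?_, hbv⟩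
  rintro rfl
  exact h₁ hbv

end Tree

/-- The copies of the centers (`p`, `q`) and of their other neighbors (`a`, `b`), where copies of
different vertices with the same role and the same index are identified. -/
inductive CoreNode
  | p₀ | p₁ | p₂ | q₀ | q₁ | a₀ | a₁ | b₀ | b₁
  deriving DecidableEq

namespace CoreNode

def toRole : CoreNode → Role
  | p₀ | p₁ | p₂ => .center₁
  | q₀ | q₁ => .center₂
  | a₀ | a₁ => .inner₁
  | b₀ | b₁ => .inner₂

def idx : CoreNode → ℕ
  | p₀ | q₀ | a₀ | b₀ => 0
  | p₁ | q₁ | a₁ | b₁ => 1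
  | p₂ => 2

def out : CoreNode → List CoreNode
  | p₀ => [a₁]
  | p₁ => [a₀]
  | p₂ => [q₀, q₁]
  | q₀ => [p₀, p₁, b₁]
  | q₁ => [p₀, p₁, b₀]
  | a₀ => [p₀, p₂]
  | a₁ => [p₁, p₂]
  | b₀ => [q₀]
  | b₁ => [q₁]

/-- Whether there is a nonempty walk of length at most `n` along `out`. -/
def reach : ℕ → CoreNode → CoreNode → Bool
  | 0, _, _ => false
  | n + 1, c, c' => (out c).any fun w => w == c' || reach n w c'

lemma reach_of_costs : ∀ (c c' : CoreNode) (k l : Fin 2), (k = 1 → c = a₁ ∨ c = b₁) →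
    (l = 1 → c' = a₀ ∨ c' = b₀) → reach (5 - (k : ℕ) - (l : ℕ)) c c' := by
  intro c c'
  cases c <;> cases c' <;> decide

lemma reach_four_self : ∀ c : CoreNode, reach 4 c c := by
  intro c
  cases c <;> decide

lemma arc_of_mem_out {c w : CoreNode} (h : w ∈ out c) : arc c.toRole c.idx w.toRole w.idx := by
  revert h
  cases c <;> cases w <;> simp [out, arc, toRole, idx]

end CoreNode

open CoreNode

section Orientation

variable {T : SimpleGraph V} {v₁ v₂ : V} {s : V → ℕ}

/-- `x` is one of the copies represented by the core node `c`. -/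
def Located (T : SimpleGraph V) (v₁ v₂ : V) (c : CoreNode) (x : Σ v : V, Fin (s v)) : Prop :=
  role T v₁ v₂ x.1 = c.toRole ∧ x.2.val = c.idx

lemma Located.adj (hadj : T.Adj v₁ v₂) {c w : CoreNode} {x y : Σ v : V, Fin (s v)}
    (hx : Located T v₁ v₂ c x) (hy : Located T v₁ v₂ w y) (h : w ∈ out c) :
    (vertexMult T s).Adj x y := by
  change T.Adj x.1 y.1
  have hx := hx.1
  have hy := hy.1
  revert h
  cases c <;> cases w <;> simp only [out, toRole] at hx hy ⊢ <;>
    grind [eq_of_role_center₁, eq_of_role_center₂, adj_of_role_inner₁, adj_of_role_inner₂,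
      SimpleGraph.Adj.symm]

variable {D : (Σ v : V, Fin (s v)) → (Σ v : V, Fin (s v)) → Prop}

lemma Located.dPath_of_reach
    (hDarc : ∀ x y : Σ v : V, Fin (s v), (vertexMult T s).Adj x y →
      arc (role T v₁ v₂ x.1) x.2 (role T v₁ v₂ y.1) y.2 → D x y)
    (hadj : T.Adj v₁ v₂)
    (hex : ∀ c, ∃ x : Σ v : V, Fin (s v), Located T v₁ v₂ c x) {n : ℕ}
    {c c' : CoreNode} {x y : Σ v : V, Fin (s v)} (hx : Located T v₁ v₂ c x)
    (hy : Located T v₁ v₂ c' y) (h : reach n c c') : ∃ k, 1 ≤ k ∧ k ≤ n ∧ DPath D k x y := by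
  have step {c w : CoreNode} {x y : Σ v : V, Fin (s v)} (hx : Located T v₁ v₂ c x)
      (hy : Located T v₁ v₂ w y) (h : w ∈ out c) : D x y := by
    refine hDarc x y (hx.adj hadj hy h) ?_
    rw [hx.1, hx.2, hy.1, hy.2]
    exact arc_of_mem_out h
  induction n generalizing c x with
  | zero => simp [reach] at h
  | succ n ih =>
    simp only [reach, List.any_eq_true, Bool.or_eq_true, beq_iff_eq] at h
    obtain ⟨w, hw, rfl | h⟩ := h
    · exact ⟨1, le_rfl, by omega, .single (step hx hy hw)⟩
    · obtain ⟨z, hz⟩ := hex w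
      obtain ⟨k, hk1, hkn, hk⟩ := ih hz h
      exact ⟨k + 1, by omega, by omega, z, step hx hz hw, hk⟩

/-- Every vertex is a copy represented by a core node, or lies on a directed path of length 2
between two such copies. -/
lemma exists_located_or_between
    (hDarc : ∀ x y : Σ v : V, Fin (s v), (vertexMult T s).Adj x y →
      arc (role T v₁ v₂ x.1) x.2 (role T v₁ v₂ y.1) y.2 → D x y)
    (hT : T.IsTree) (hadj : T.Adj v₁ v₂) (hecc₁ : ecc T v₁ = 3)
    (hecc₂ : ecc T v₂ = 3) (hs₁ : s v₁ = 3) (hs : ∀ v : V, v ≠ v₁ → s v = 2)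
    (x : Σ v : V, Fin (s v)) :
    (∃ c, Located T v₁ v₂ c x) ∨
      ∃ c c' y z, Located T v₁ v₂ c y ∧ Located T v₁ v₂ c' z ∧ D x y ∧ D z x ∧
        (c = a₁ ∧ c' = a₀ ∨ c = b₁ ∧ c' = b₀) := by
  have h2 (v : V) : 2 ≤ s v := by
    by_cases h : v = v₁
    · subst h; omega
    · exact (hs v h).ge
  obtain ⟨v, i, hi⟩ := x
  have hcore (hv : v ≠ v₁) : i = 0 ∨ i = 1 := by
    have := hs v hv
    omega
  have ne_of_role {r : Role} (hr : role T v₁ v₂ v = r) (h : r ≠ .center₁) : v ≠ v₁ := by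
    rintro rfl
    exact h (hr.symm.trans role_center₁)
  cases hv : role T v₁ v₂ v with
  | center₁ =>
    left
    obtain rfl := eq_of_role_center₁ hv
    obtain rfl | rfl | rfl : i = 0 ∨ i = 1 ∨ i = 2 := by omega
    exacts [⟨p₀, hv, rfl⟩, ⟨p₁, hv, rfl⟩, ⟨p₂, hv, rfl⟩]
  | center₂ =>
    left
    obtain rfl | rfl := hcore (ne_of_role hv (by simp))
    exacts [⟨q₀, hv, rfl⟩, ⟨q₁, hv, rfl⟩]
  | inner₁ =>
    left
    obtain rfl | rfl := hcore (ne_of_role hv (by simp))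
    exacts [⟨a₀, hv, rfl⟩, ⟨a₁, hv, rfl⟩]
  | inner₂ =>
    left
    obtain rfl | rfl := hcore (ne_of_role hv (by simp))
    exacts [⟨b₀, hv, rfl⟩, ⟨b₁, hv, rfl⟩]
  | leaf₁ =>
    right
    obtain ⟨a, ha, hav⟩ := exists_inner₁_of_role_leaf₁ hv
    refine ⟨a₁, a₀, ⟨a, 1, h2 a⟩, ⟨a, 0, (h2 a).trans_lt' zero_lt_two⟩, ⟨ha, rfl⟩, ⟨ha, rfl⟩,
      hDarc _ _ hav.symm ?_, hDarc _ _ hav ?_, by simp⟩ <;> simp [ha, hv, arc]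
  | leaf₂ =>
    right
    obtain ⟨b, hb, hbv⟩ := exists_inner₂_of_role_leaf₂ hT hadj hecc₁ hecc₂ hv
    refine ⟨b₁, b₀, ⟨b, 1, h2 b⟩, ⟨b, 0, (h2 b).trans_lt' zero_lt_two⟩, ⟨hb, rfl⟩, ⟨hb, rfl⟩,
      hDarc _ _ hbv.symm ?_, hDarc _ _ hbv ?_, by simp⟩ <;> simp [hb, hv, arc]

end Orientation

lemma exists_located [Finite V] {T : SimpleGraph V} {v₁ v₂ : V} {s : V → ℕ} (hT : T.IsTree)
    (hadj : T.Adj v₁ v₂) (hecc₁ : ecc T v₁ = 3) (hecc₂ : ecc T v₂ = 3) (hs₁ : s v₁ = 3)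
    (hs : ∀ v : V, v ≠ v₁ → s v = 2) (c : CoreNode) :
    ∃ x : Σ v : V, Fin (s v), Located T v₁ v₂ c x := by
  obtain ⟨a, ha, hav⟩ := exists_adj_ne_of_ecc_eq_three hT hadj hecc₁ hecc₂
  obtain ⟨b, hb, hbv⟩ := exists_adj_ne_of_ecc_eq_three hT hadj.symm hecc₂ hecc₁
  obtain ⟨v, hv, hc⟩ : ∃ v, role T v₁ v₂ v = c.toRole ∧ c.idx < s v := by
    have h₂ := hs v₂ hadj.ne'
    have hsa := hs a ha.ne'
    have hsb := hs b hbv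
    cases c
    case p₀ | p₁ | p₂ => exact ⟨v₁, role_center₁, by simp [idx, hs₁]⟩
    case q₀ | q₁ => exact ⟨v₂, role_center₂ hadj, by simp [idx, h₂]⟩
    case a₀ | a₁ => exact ⟨a, role_inner₁ ha hav, by simp [idx, hsa]⟩
    case b₀ | b₁ => exact ⟨b, role_inner₂ hT hadj hb hbv, by simp [idx, hsb]⟩
  exact ⟨⟨v, c.idx, hc⟩, hv, rfl⟩

theorem stmt14 [Fintype V] (T : SimpleGraph V) (hT : T.IsTree) (hdiam : T.ediam = 5)
    (v₁ v₂ : V) (hadj : T.Adj v₁ v₂) (hecc₁ : ecc T v₁ = 3) (hecc₂ : ecc T v₂ = 3)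
    (s : V → ℕ) (hs₁ : s v₁ = 3) (hs : ∀ v : V, v ≠ v₁ → s v = 2) :
    ∃ D : (Σ v : V, Fin (s v)) → (Σ v : V, Fin (s v)) → Prop,
      IsOrientation (vertexMult T s) D ∧ odiam D = 5 ∧
      ∀ x : Σ v : V, Fin (s v), ∃ k : ℕ, 1 ≤ k ∧ k ≤ 4 ∧ DPath D k x x := by
  obtain ⟨D, hD, hDarc⟩ := exists_isOrientation_of_asymm (vertexMult T s)
    (fun x y => arc (role T v₁ v₂ x.1) x.2 (role T v₁ v₂ y.1) y.2) fun _ _ => arc_asymm _ _ _ _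
  have hex := exists_located hT hadj hecc₁ hecc₂ hs₁ hs
  have hcases := exists_located_or_between hDarc hT hadj hecc₁ hecc₂ hs₁ hs
  have hpos (v : V) : 0 < s v := by
    by_cases h : v = v₁
    · subst h; omega
    · have := hs v h; omega
  have hfrom (x : Σ v : V, Fin (s v)) : ∃ (c : CoreNode) (k : Fin 2) (y : _),
      Located T v₁ v₂ c y ∧ DPath D k x y ∧ (k = 1 → c = a₁ ∨ c = b₁) := by
    obtain ⟨c, hc⟩ | ⟨c, c', y, z, hy, hz, hxy, hzx, h⟩ := hcases x
    · exact ⟨c, 0, x, hc, rfl, by simp⟩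
    · exact ⟨c, 1, y, hy, .single hxy, by tauto⟩
  have hto (x : Σ v : V, Fin (s v)) : ∃ (c : CoreNode) (k : Fin 2) (y : _),
      Located T v₁ v₂ c y ∧ DPath D k y x ∧ (k = 1 → c = a₀ ∨ c = b₀) := by
    obtain ⟨c, hc⟩ | ⟨c, c', y, z, hy, hz, hxy, hzx, h⟩ := hcases x
    · exact ⟨c, 0, x, hc, rfl, by simp⟩
    · exact ⟨c', 1, z, hz, .single hzx, by tauto⟩
  refine ⟨D, hD, le_antisymm (iSup₂_le fun x y => ?_) (hdiam ▸ ediam_le_odiam hpos hD),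
    fun x => ?_⟩
  · obtain ⟨c, k, x', hx', hk, hkc⟩ := hfrom x
    obtain ⟨c', l, y', hy', hl, hlc⟩ := hto y
    obtain ⟨m, -, hm, hpath⟩ :=
      hx'.dPath_of_reach hDarc hadj hex hy' (reach_of_costs c c' k l hkc hlc)
    exact ddist_le_of_dPath (n := 5) ((hk.trans hpath).trans hl) (by omega)
  · obtain ⟨c, hc⟩ | ⟨c, c', y, z, hy, hz, hxy, hzx, h⟩ := hcases x
    · exact hc.dPath_of_reach hDarc hadj hex hc (reach_four_self c)
    · have hreach : reach 2 c c' := by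
        obtain ⟨rfl, rfl⟩ | ⟨rfl, rfl⟩ := h <;> decide
      obtain ⟨m, -, hm, hpath⟩ := hy.dPath_of_reach hDarc hadj hex hz hreach
      exact ⟨1 + m + 1, by omega, by omega,
        ((DPath.single_s14 hxy).trans hpath).trans (.single hzx)⟩
end
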